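/- Let I be a nonempty finite index set and let X⁰ = (X⁰_i)_{i∈I} and X¹ = (X¹_i)_{i∈I} be centered Gaussian random vectors with positive definite covariance matrices Δ⁰ and Δ¹ respectively, each with unit variances (Δ⁰_{ii} = Δ¹_{ii} = 1 for all i) and with |Δ⁰_{ij}| < 1 and |Δ¹_{ij}| < 1 for all i ≠ j. For h ∈ [0,1] set Δ^h = h·Δ⁰ + (1−h)·Δ¹, and set Δ^m_{ij} = max{Δ⁰_{ij}, Δ¹_{ij}}. Then for every s ∈ ℝ, P(max_{i∈I} X⁰_i ≤ s) − P(max_{i∈I} X¹_i ≤ s) ≤ Σ_{i≠j in I} (Δ⁰_{ij} − Δ¹_{ij})⁺ · exp(−s²/(1+Δ^m_{ij})) · ∫₀¹ (1 − (Δ^h_{ij})²)^{-1/2} dh, where (x)⁺ = max{x, 0}. -/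

import Mathlib

open MeasureTheory ProbabilityTheory

/-- `X` is a centered Gaussian random vector with covariance matrix `Δ`:
every linear combination of the coordinates is a centered real Gaussian
with the corresponding variance. -/
def IsCenteredGaussianVector {Ω : Type*} [MeasurableSpace Ω] (P : Measure Ω)
    {I : Type*} [Fintype I] (X : I → Ω → ℝ) (Δ : Matrix I I ℝ) : Prop :=
  ∀ c : I → ℝ, Measure.map (fun ω => ∑ i, c i * X i ω) P =
    gaussianReal 0 (Real.toNNReal (∑ i, ∑ j, c i * c j * Δ i j))

namespace GC

lemma aemeas {Ω : Type*} [MeasurableSpace Ω] {P : Measure Ω}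
    {I : Type*} [Fintype I] [DecidableEq I] {X : I → Ω → ℝ} {Δ : Matrix I I ℝ}
    (h : IsCenteredGaussianVector P X Δ) (i : I) : AEMeasurable (X i) P := by
  have := h (Pi.single i 1)
  apply AEMeasurable.of_map_ne_zero
  have e : (fun ω => ∑ k, (Pi.single i 1 : I → ℝ) k * X k ω) = X i := by
    ext ω; simp [Pi.single_apply]
  rw [e] at this
  rw [this]
  exact IsProbabilityMeasure.ne_zero _

lemma gaussLaw {Ω : Type*} [MeasurableSpace Ω] {P : Measure Ω}
    {I : Type*} [Fintype I] [DecidableEq I] {X : I → Ω → ℝ} {Δ : Matrix I I ℝ}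
    (h : IsCenteredGaussianVector P X Δ) : HasGaussianLaw (fun ω i => X i ω) P where
  isGaussian_map := by
    have hm := aemeas h
    refine isGaussian_of_map_eq_gaussianReal fun L => ?_
    refine ⟨0, _, Eq.trans ?_ (h (fun i => L (Pi.single i 1)))⟩
    · rw [AEMeasurable.map_map_of_aemeasurable (by fun_prop) (aemeasurable_pi_lambda _ hm)]
      congr 1
      ext ω
      refine (LinearMap.pi_apply_eq_sum_univ (L : (I → ℝ) →ₗ[ℝ] ℝ) (fun a => X a ω)).trans ?_
      refine Finset.sum_congr rfl fun i _ => ?_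
      rw [mul_comm, smul_eq_mul]
      refine congrArg₂ _ rfl (congrArg L ?_)
      ext j
      simp [Pi.single_apply, eq_comm]

lemma mean_zero {Ω : Type*} [MeasurableSpace Ω] {P : Measure Ω}
    {I : Type*} [Fintype I] [DecidableEq I] {X : I → Ω → ℝ} {Δ : Matrix I I ℝ}
    (h : IsCenteredGaussianVector P X Δ) (i : I) : ∫ ω, X i ω ∂P = 0 := by
  have := h (Pi.single i 1)
  have e : (fun ω => ∑ k, (Pi.single i 1 : I → ℝ) k * X k ω) = X i := by
    ext ω; simp [Pi.single_apply]
  rw [e] at this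
  rw [← integral_map (φ := X i) (f := fun x => x) (aemeas h i) (by fun_prop), this,
    integral_id_gaussianReal]

lemma var_comb {Ω : Type*} [MeasurableSpace Ω] {P : Measure Ω}
    {I : Type*} [Fintype I] [DecidableEq I] {X : I → Ω → ℝ} {Δ : Matrix I I ℝ}
    (h : IsCenteredGaussianVector P X Δ) (c : I → ℝ)
    (hc : 0 ≤ ∑ i, ∑ j, c i * c j * Δ i j) :
    Var[fun ω => ∑ i, c i * X i ω; P] = ∑ i, ∑ j, c i * c j * Δ i j := by
  have hm := aemeas h
  have := variance_map (X := fun x : ℝ => x) (Y := fun ω => ∑ i, c i * X i ω) (μ := P)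
    (by fun_prop) (by fun_prop)
  rw [h c, variance_fun_id_gaussianReal] at this
  simp only [Function.comp_def] at this
  rw [← this, Real.coe_toNNReal _ hc]

lemma cov_eq {Ω : Type*} [MeasurableSpace Ω] {P : Measure Ω} [IsProbabilityMeasure P]
    {I : Type*} [Fintype I] [DecidableEq I] {X : I → Ω → ℝ} {Δ : Matrix I I ℝ}
    (h : IsCenteredGaussianVector P X Δ) (hPD : Δ.PosDef) (i j : I) :
    cov[X i, X j; P] = Δ i j := by
  have hnn : ∀ c : I → ℝ, 0 ≤ ∑ i, ∑ j, c i * c j * Δ i j := by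
    intro c
    have := hPD.posSemidef.dotProduct_mulVec_nonneg c
    simp only [dotProduct, Matrix.mulVec, star_trivial] at this
    refine this.trans_eq (Finset.sum_congr rfl fun i _ => ?_)
    rw [Finset.mul_sum]
    exact Finset.sum_congr rfl fun j _ => by ring
  have hsymm : Δ j i = Δ i j := by
    have := hPD.1.apply i j; simpa using this
  have hL := gaussLaw h
  have hml : ∀ k, MemLp (X k) 2 P := fun k => (hL.eval k).memLp_two
  have hv : ∀ k, Var[X k; P] = Δ k k := by
    intro k
    have := var_comb h (Pi.single k 1) (hnn _)
    have e : (fun ω => ∑ l, (Pi.single k 1 : I → ℝ) l * X l ω) = X k := by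
      ext ω; simp [Pi.single_apply]
    rw [e] at this
    rw [this]; simp [Pi.single_apply]
  have h2 := var_comb h (Pi.single i 1 + Pi.single j 1) (hnn _)
  have e : (fun ω => ∑ l, (Pi.single i 1 + Pi.single j 1 : I → ℝ) l * X l ω) = X i + X j := by
    ext ω; simp [Pi.single_apply, add_mul, Finset.sum_add_distrib]
  rw [e, variance_add (hml i) (hml j), hv, hv] at h2
  simp [Pi.single_apply, add_mul, mul_add, Finset.sum_add_distrib, hsymm] at h2
  linarith

/-- One-dimensional Stein identity. -/
lemma stein {g g' : ℝ → ℝ} {M : ℝ} (hg : ∀ x, HasDerivAt g (g' x) x) (hg'c : Continuous g')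
    (hM : ∀ x, |g x| ≤ M) (hM' : ∀ x, |g' x| ≤ M) :
    ∫ x, x * g x ∂(gaussianReal 0 1) = ∫ x, g' x ∂(gaussianReal 0 1) := by
  have hgc : Continuous g := continuous_iff_continuousAt.2 fun x => (hg x).continuousAt
  rw [integral_gaussianReal_eq_integral_smul (by simp),
    integral_gaussianReal_eq_integral_smul (by simp)]
  simp only [smul_eq_mul]
  have hp : ∀ x, gaussianPDFReal 0 1 x = (Real.sqrt (2 * Real.pi))⁻¹ * Real.exp (- x ^ 2 / 2) := by
    intro x; simp [gaussianPDFReal]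
  have hd : ∀ x, HasDerivAt (gaussianPDFReal 0 1) (- x * gaussianPDFReal 0 1 x) x := by
    intro x
    have e : gaussianPDFReal 0 1 = fun x => (Real.sqrt (2 * Real.pi))⁻¹ * Real.exp (- x ^ 2 / 2) :=
      funext hp
    rw [e]
    have h1 : HasDerivAt (fun x : ℝ => - x ^ 2 / 2) (-x) x := by
      have := ((hasDerivAt_id x).pow 2).neg.div_const 2
      convert! this using 1
      simp; ring
    convert! (h1.exp.const_mul _) using 1
    ring
  have hpi := integrable_gaussianPDFReal 0 1
  have hxi : Integrable (fun x => x * gaussianPDFReal 0 1 x) := by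
    have h0 := (integrable_mul_exp_neg_mul_sq (b := 1/2) (by norm_num)).const_mul
      ((Real.sqrt (2 * Real.pi))⁻¹)
    refine h0.congr (Filter.Eventually.of_forall fun x => ?_)
    simp only [hp]
    ring_nf
  have bdd : ∀ {u f : ℝ → ℝ}, Continuous f → (∀ x, |f x| ≤ M) → Integrable u →
      Integrable (f * u) := by
    intro u f hf hb hu
    exact hu.bdd_mul hf.aestronglyMeasurable (Filter.Eventually.of_forall fun x => hb x)
  have key := integral_mul_deriv_eq_deriv_mul_of_integrable (u := g) (u' := g')
    (v := gaussianPDFReal 0 1) (v' := fun x => - x * gaussianPDFReal 0 1 x)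
    (fun x _ => hg x) (fun x _ => hd x)
    (bdd hgc hM (by simpa using hxi.neg))
    (bdd hg'c hM' hpi) (bdd hgc hM hpi)
  have e1 : ∫ x, gaussianPDFReal 0 1 x * (x * g x) = - ∫ x, g x * (-x * gaussianPDFReal 0 1 x) := by
    rw [← integral_neg]; congr 1; ext x; ring
  rw [e1, key, neg_neg]; congr 1; ext x; ring

lemma stein_indep {Ω E : Type*} [MeasurableSpace Ω] {P : Measure Ω} [IsProbabilityMeasure P]
    [MeasurableSpace E] {W : Ω → ℝ} {Z : Ω → E}
    (hind : IndepFun W Z P) (hW : P.map W = gaussianReal 0 1) (hWm : AEMeasurable W P)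
    (hZm : AEMeasurable Z P) {G G' : E → ℝ → ℝ} {M : ℝ}
    (hG : Measurable (Function.uncurry G)) (hG' : Measurable (Function.uncurry G'))
    (hd : ∀ z w, HasDerivAt (G z) (G' z w) w) (hc : ∀ z, Continuous (G' z))
    (hM : ∀ z w, |G z w| ≤ M) (hM' : ∀ z w, |G' z w| ≤ M) :
    ∫ ω, W ω * G (Z ω) (W ω) ∂P = ∫ ω, G' (Z ω) (W ω) ∂P := by
  have hprod := (indepFun_iff_map_prod_eq_prod_map_map hWm hZm).1 hind
  rw [hW] at hprod
  have : IsProbabilityMeasure (P.map Z) := Measure.isProbabilityMeasure_map hZm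
  have hm := hWm.prodMk hZm
  have hG1 : Measurable fun p : ℝ × E => p.1 * G p.2 p.1 :=
    measurable_fst.mul (hG.comp (measurable_snd.prodMk measurable_fst))
  have hG2 : Measurable fun p : ℝ × E => G' p.2 p.1 :=
    (hG'.comp (measurable_snd.prodMk measurable_fst))
  have e1 := integral_map (f := fun p : ℝ × E => p.1 * G p.2 p.1) hm hG1.aestronglyMeasurable
  have e2 := integral_map (f := fun p : ℝ × E => G' p.2 p.1) hm hG2.aestronglyMeasurable
  simp only at e1 e2
  rw [← e1, ← e2, hprod, integral_prod_symm, integral_prod_symm]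
  · congr 1; ext z
    exact stein (hd z) (hc z) (hM z) (hM' z)
  · refine Integrable.of_bound hG2.aestronglyMeasurable M (Filter.Eventually.of_forall fun p => ?_)
    exact hM' _ _
  · have hid : Integrable (fun x : ℝ => x) (gaussianReal 0 1) :=
      memLp_one_iff_integrable.1 (memLp_id_gaussianReal' 1 (by simp))
    have := hid.comp_fst (P.map Z)
    refine Integrable.mul_bdd (c := M) this (hG.comp (measurable_snd.prodMk measurable_fst)).aestronglyMeasurable ?_
    exact Filter.Eventually.of_forall fun p => hM _ _

end GC
namespace GC

lemma quad_bound {x y r q : ℝ} (hr1 : -1 < r) (hr2 : r < 1) (hq : q ≤ ((x + y) / 2) ^ 2) :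
    gaussianPDFReal 0 1 x * gaussianPDFReal 0 1 ((y - r * x) / Real.sqrt (1 - r ^ 2))
      ≤ Real.exp (-q / (1 + r)) := by
  have h1 : 0 < 1 - r ^ 2 := by nlinarith
  have hpi : (Real.sqrt (2 * Real.pi))⁻¹ ≤ 1 := by
    apply inv_le_one_of_one_le₀
    rw [Real.one_le_sqrt]
    nlinarith [Real.pi_gt_three]
  have hp : ∀ x, gaussianPDFReal 0 1 x ≤ Real.exp (- x ^ 2 / 2) := by
    intro x
    simp only [gaussianPDFReal, NNReal.coe_one, mul_one, sub_zero]
    exact mul_le_of_le_one_left (Real.exp_nonneg _) hpi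
  refine (mul_le_mul (hp _) (hp _) (gaussianPDFReal_nonneg _ _ _) (Real.exp_nonneg _)).trans ?_
  rw [← Real.exp_add]
  apply Real.exp_le_exp.2
  rw [div_pow, Real.sq_sqrt h1.le]
  have h2 : 0 < 1 + r := by linarith
  have h3 : 0 < 1 - r := by linarith
  have e : -x ^ 2 / 2 + -((y - r * x) ^ 2 / (1 - r ^ 2)) / 2
      = - ((x + y) / 2) ^ 2 / (1 + r) - (x - y) ^ 2 / (4 * (1 - r)) := by
    have : 1 - r ^ 2 = (1 + r) * (1 - r) := by ring
    rw [this]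
    field_simp
    ring
  rw [e]
  have h4 : 0 ≤ (x - y) ^ 2 / (4 * (1 - r)) := by positivity
  have h5 : - ((x + y) / 2) ^ 2 / (1 + r) ≤ -q / (1 + r) := by
    gcongr
  linarith

lemma density_bound {Ω : Type*} [MeasurableSpace Ω] {P : Measure Ω} [IsProbabilityMeasure P]
    {U V : Ω → ℝ} (hind : IndepFun U V P) (hU : P.map U = gaussianReal 0 1)
    (hV : P.map V = gaussianReal 0 1) (hUm : AEMeasurable U P) (hVm : AEMeasurable V P)
    {g : ℝ → ℝ} (hgc : Continuous g) (hg0 : ∀ x, 0 ≤ g x) {s ε q M : ℝ}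
    (hM : ∀ x, g x ≤ M)
    (hsupp : ∀ x, g x ≠ 0 → s ≤ x ∧ x ≤ s + ε) (hgi : Integrable g) (hg1 : ∫ x, g x = 1)
    {r : ℝ} (hr1 : -1 < r) (hr2 : r < 1) (hq : ∀ u, s ≤ u → u ≤ s + ε → q ≤ u ^ 2) :
    ∫ ω, g (U ω) * g (r * U ω + Real.sqrt (1 - r ^ 2) * V ω) ∂P
      ≤ Real.exp (-q / (1 + r)) * (Real.sqrt (1 - r ^ 2))⁻¹ := by
  have h1 : 0 < 1 - r ^ 2 := by nlinarith
  set σ := Real.sqrt (1 - r ^ 2) with hσ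
  have hσ0 : 0 < σ := Real.sqrt_pos.2 h1
  set K := Real.exp (-q / (1 + r)) with hK
  have hprod := (indepFun_iff_map_prod_eq_prod_map_map hUm hVm).1 hind
  rw [hU, hV] at hprod
  have hm := hUm.prodMk hVm
  have hGc : Continuous fun p : ℝ × ℝ => g p.1 * g (r * p.1 + σ * p.2) := by fun_prop
  have e1 := integral_map (f := fun p : ℝ × ℝ => g p.1 * g (r * p.1 + σ * p.2)) hm
    hGc.aestronglyMeasurable
  simp only at e1
  have hM0 : 0 ≤ M := (hg0 0).trans (hM 0)
  have hintg : Integrable (fun p : ℝ × ℝ => g p.1 * g (r * p.1 + σ * p.2))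
      ((gaussianReal 0 1).prod (gaussianReal 0 1)) := by
    refine Integrable.of_bound hGc.aestronglyMeasurable (M * M)
      (Filter.Eventually.of_forall fun p => ?_)
    rw [Real.norm_of_nonneg (mul_nonneg (hg0 _) (hg0 _))]
    exact mul_le_mul (hM _) (hM _) (hg0 _) hM0
  rw [← e1, hprod, integral_prod _ hintg]
  rw [integral_gaussianReal_eq_integral_smul (by simp)]
  have inner : ∀ x, gaussianPDFReal 0 1 x • ∫ y, g x * g (r * x + σ * y) ∂(gaussianReal 0 1)
      ≤ g x * (K * σ⁻¹) := by
    intro x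
    rw [integral_const_mul, smul_eq_mul, integral_gaussianReal_eq_integral_smul (by simp)]
    by_cases hx : g x = 0
    · simp [hx]
    obtain ⟨hx1, hx2⟩ := hsupp x hx
    have cov : ∫ v, gaussianPDFReal 0 1 v • g (r * x + σ * v)
        = σ⁻¹ * ∫ y, gaussianPDFReal 0 1 ((y - r * x) / σ) * g y := by
      have a1 := Measure.integral_comp_mul_left
        (fun t => gaussianPDFReal 0 1 (t / σ) * g (r * x + t)) σ
      have a2 := integral_add_left_eq_self (μ := volume)
        (fun y => gaussianPDFReal 0 1 ((y - r * x) / σ) * g y) (r * x)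
      simp only [smul_eq_mul] at a1 ⊢
      rw [abs_of_pos (inv_pos.2 hσ0)] at a1
      rw [← a2]
      simp only [add_sub_cancel_left]
      rw [← a1]
      congr 1
      ext v
      congr 2
      field_simp
    rw [cov]
    have b1 : gaussianPDFReal 0 1 x * ∫ y, gaussianPDFReal 0 1 ((y - r * x) / σ) * g y ≤ K := by
      rw [← integral_const_mul]
      calc _ ≤ ∫ y, K * g y := by
            refine integral_mono_of_nonneg (Filter.Eventually.of_forall fun y => ?_)
              (hgi.const_mul K) (Filter.Eventually.of_forall fun y => ?_)
            · exact mul_nonneg (gaussianPDFReal_nonneg _ _ _)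
                (mul_nonneg (gaussianPDFReal_nonneg _ _ _) (hg0 _))
            · by_cases hy : g y = 0
              · simp [hy]
              obtain ⟨hy1, hy2⟩ := hsupp y hy
              simp only
              rw [← mul_assoc]
              refine mul_le_mul_of_nonneg_right ?_ (hg0 y)
              exact quad_bound hr1 hr2 (hq _ (by linarith) (by linarith))
        _ = K := by rw [integral_const_mul, hg1, mul_one]
    calc _ = g x * ((gaussianPDFReal 0 1 x *
              ∫ y, gaussianPDFReal 0 1 ((y - r * x) / σ) * g y) * σ⁻¹) := by ring
      _ ≤ _ := by
        refine mul_le_mul_of_nonneg_left ?_ (hg0 x)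
        exact mul_le_mul_of_nonneg_right b1 (inv_pos.2 hσ0).le
  calc _ ≤ ∫ x, g x * (K * σ⁻¹) := by
        refine integral_mono_of_nonneg (Filter.Eventually.of_forall fun x => ?_)
          (hgi.mul_const _) (Filter.Eventually.of_forall inner)
        exact smul_nonneg (gaussianPDFReal_nonneg _ _ _)
          (integral_nonneg fun y => mul_nonneg (hg0 _) (hg0 _))
    _ = K * σ⁻¹ := by rw [integral_mul_const, hg1, one_mul]

/-- Smooth cutoff. -/
lemma exists_cutoff (s ε : ℝ) (hε : 0 < ε) : ∃ (φ g : ℝ → ℝ) (M : ℝ),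
    (∀ x, HasDerivAt φ (- g x) x) ∧ Continuous g ∧ (∀ x, 0 ≤ g x) ∧ (∀ x, g x ≤ M) ∧
    (∀ x, g x ≠ 0 → s ≤ x ∧ x ≤ s + ε) ∧ Integrable g ∧ ∫ x, g x = 1 ∧
    (∀ x, 0 ≤ φ x) ∧ (∀ x, φ x ≤ 1) ∧ (∀ x, x ≤ s → φ x = 1) ∧ (∀ x, s + ε ≤ x → φ x = 0) := by
  let f : ℝ → ℝ := fun x => Real.smoothTransition ((x - s) / ε)
  have hfc : ContDiff ℝ 1 f := by
    have : ContDiff ℝ 1 Real.smoothTransition := Real.smoothTransition.contDiff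
    exact this.comp (by fun_prop)
  have hmono : Monotone f := fun a b hab => Real.smoothTransition.monotone (by gcongr)
  have hfd : ∀ x, HasDerivAt f (deriv f x) x := fun x =>
    ((hfc.differentiable (by simp)) x).hasDerivAt
  have hf0 : ∀ x, x ≤ s → f x = 0 := fun x hx =>
    Real.smoothTransition.zero_of_nonpos (div_nonpos_of_nonpos_of_nonneg (by linarith) hε.le)
  have hf1 : ∀ x, s + ε ≤ x → f x = 1 := fun x hx =>
    Real.smoothTransition.one_of_one_le (by rw [le_div_iff₀ hε]; linarith)
  have hgc : Continuous (deriv f) := hfc.continuous_deriv le_rfl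
  have hsupp : ∀ x, deriv f x ≠ 0 → s ≤ x ∧ x ≤ s + ε := by
    intro x hx
    by_contra hcon
    apply hx
    rw [not_and_or, not_le, not_le] at hcon
    rcases hcon with h | h
    · have : f =ᶠ[nhds x] fun _ => 0 := by
        filter_upwards [Iio_mem_nhds h] with y hy using hf0 y (le_of_lt hy)
      rw [this.deriv_eq]; simp
    · have : f =ᶠ[nhds x] fun _ => 1 := by
        filter_upwards [Ioi_mem_nhds h] with y hy using hf1 y (le_of_lt hy)
      rw [this.deriv_eq]; simp
  have hcs : HasCompactSupport (deriv f) := by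
    refine HasCompactSupport.of_support_subset_isCompact (isCompact_Icc (a := s) (b := s + ε)) ?_
    intro x hx; exact hsupp x hx
  have hgi : Integrable (deriv f) := hgc.integrable_of_hasCompactSupport hcs
  obtain ⟨M, hM⟩ := hgc.bounded_above_of_compact_support hcs
  refine ⟨fun x => 1 - f x, deriv f, M, fun x => ?_, hgc, fun x => hmono.deriv_nonneg,
    fun x => (le_abs_self _).trans (hM x), hsupp, hgi, ?_,
    fun x => sub_nonneg.2 (Real.smoothTransition.le_one _),
    fun x => sub_le_self _ (Real.smoothTransition.nonneg _), fun x hx => by simp [hf0 x hx],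
    fun x hx => by simp [hf1 x hx]⟩
  · simpa using (hfd x).const_sub 1
  · have h0 : Filter.Tendsto f Filter.atBot (nhds 0) := by
      refine tendsto_const_nhds.congr' ?_
      filter_upwards [Filter.eventually_le_atBot s] with x hx using (hf0 x hx).symm
    have h1 : Filter.Tendsto f Filter.atTop (nhds 1) := by
      refine tendsto_const_nhds.congr' ?_
      filter_upwards [Filter.eventually_ge_atTop (s + ε)] with x hx using (hf1 x hx).symm
    rw [integral_of_hasDerivAt_of_tendsto hfd hgi h0 h1, sub_zero]

end GC
namespace GC

/-- joint setting -/
structure Setup {Ω I : Type*} [MeasurableSpace Ω] [Fintype I] (P : Measure Ω)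
    (X Y : I → Ω → ℝ) (Δ₀ Δ₁ : Matrix I I ℝ) : Prop where
  law : HasGaussianLaw (fun ω => ((fun i => X i ω), (fun i => Y i ω))) P
  mX : ∀ i, ∫ ω, X i ω ∂P = 0
  mY : ∀ i, ∫ ω, Y i ω ∂P = 0
  cX : ∀ i j, cov[X i, X j; P] = Δ₀ i j
  cY : ∀ i j, cov[Y i, Y j; P] = Δ₁ i j
  cXY : ∀ i j, cov[X i, Y j; P] = 0

namespace Setup
set_option linter.unusedSectionVars false
variable {Ω I : Type*} [MeasurableSpace Ω] [Fintype I] [DecidableEq I] {P : Measure Ω}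
    [IsProbabilityMeasure P]
    {X Y : I → Ω → ℝ} {Δ₀ Δ₁ : Matrix I I ℝ}

lemma lX (S : Setup P X Y Δ₀ Δ₁) (i : I) : HasGaussianLaw (X i) P := S.law.fst.eval i
lemma lY (S : Setup P X Y Δ₀ Δ₁) (i : I) : HasGaussianLaw (Y i) P := S.law.snd.eval i

lemma cYX (S : Setup P X Y Δ₀ Δ₁) (i j : I) : cov[Y i, X j; P] = 0 := by
  rw [covariance_comm, S.cXY]

lemma cov_comb (S : Setup P X Y Δ₀ Δ₁) (a b c d : ℝ) (i j : I) :
    cov[fun ω => a * X i ω + b * Y i ω, fun ω => c * X j ω + d * Y j ω; P]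
      = a * c * Δ₀ i j + b * d * Δ₁ i j := by
  have h1 := fun k => (S.lX k).memLp_two
  have h2 := fun k => (S.lY k).memLp_two
  have e : ∀ (a b : ℝ) (i : I), (fun ω => a * X i ω + b * Y i ω)
      = (fun ω => a * X i ω) + (fun ω => b * Y i ω) := fun a b i => rfl
  rw [e, e, covariance_add_left ((h1 i).const_mul a) ((h2 i).const_mul b)
      (((h1 j).const_mul c).add ((h2 j).const_mul d)),
    covariance_add_right ((h1 i).const_mul a) ((h1 j).const_mul c) ((h2 j).const_mul d),
    covariance_add_right ((h2 i).const_mul b) ((h1 j).const_mul c) ((h2 j).const_mul d)]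
  simp only [covariance_const_mul_left, covariance_const_mul_right, S.cX, S.cY, S.cXY, S.cYX]
  ring

lemma law_comb (S : Setup P X Y Δ₀ Δ₁) (a b : ℝ) (i : I) (h0 : Δ₀ i i = 1) (h1 : Δ₁ i i = 1)
    (hab : a ^ 2 + b ^ 2 = 1) :
    P.map (fun ω => a * X i ω + b * Y i ω) = gaussianReal 0 1 := by
  have hl : HasGaussianLaw (fun ω => a * X i ω + b * Y i ω) P := by
    have := S.law.map (a • (ContinuousLinearMap.proj i).comp (ContinuousLinearMap.fst ℝ _ _)
      + b • (ContinuousLinearMap.proj (R := ℝ) (φ := fun _ : I => ℝ) i).comp (ContinuousLinearMap.snd ℝ (I → ℝ) (I → ℝ)))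
    simpa [Function.comp_def] using this
  rw [hl.map_eq_gaussianReal]
  have m : ∫ ω, a * X i ω + b * Y i ω ∂P = 0 := by
    rw [integral_add ((S.lX i).integrable.const_mul a) ((S.lY i).integrable.const_mul b),
      integral_const_mul, integral_const_mul, S.mX, S.mY]; simp
  have v : Var[fun ω => a * X i ω + b * Y i ω; P] = 1 := by
    rw [← covariance_self hl.aemeasurable, S.cov_comb, h0, h1]; linarith
  rw [m, v]; simp

/-- bound for the pair density -/
lemma pair_bound (S : Setup P X Y Δ₀ Δ₁) (h0 : ∀ i, Δ₀ i i = 1) (h1 : ∀ i, Δ₁ i i = 1)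
    (hsym0 : ∀ i j, Δ₀ i j = Δ₀ j i) (hsym1 : ∀ i j, Δ₁ i j = Δ₁ j i)
    {a b : ℝ} (hab : a ^ 2 + b ^ 2 = 1) (i j : I)
    {g : ℝ → ℝ} (hgc : Continuous g) (hg0 : ∀ x, 0 ≤ g x) {s ε q M : ℝ}
    (hM : ∀ x, g x ≤ M)
    (hsupp : ∀ x, g x ≠ 0 → s ≤ x ∧ x ≤ s + ε) (hgi : Integrable g) (hg1 : ∫ x, g x = 1)
    (hr1 : -1 < a ^ 2 * Δ₀ i j + b ^ 2 * Δ₁ i j) (hr2 : a ^ 2 * Δ₀ i j + b ^ 2 * Δ₁ i j < 1)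
    (hq : ∀ u, s ≤ u → u ≤ s + ε → q ≤ u ^ 2) :
    ∫ ω, g (a * X i ω + b * Y i ω) * g (a * X j ω + b * Y j ω) ∂P
      ≤ Real.exp (-q / (1 + (a ^ 2 * Δ₀ i j + b ^ 2 * Δ₁ i j))) *
        (Real.sqrt (1 - (a ^ 2 * Δ₀ i j + b ^ 2 * Δ₁ i j) ^ 2))⁻¹ := by
  set r := a ^ 2 * Δ₀ i j + b ^ 2 * Δ₁ i j with hr
  set σ := Real.sqrt (1 - r ^ 2) with hσ
  have hp : 0 < 1 - r ^ 2 := by nlinarith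
  have hσ0 : 0 < σ := Real.sqrt_pos.2 hp
  have hσ2 : σ ^ 2 = 1 - r ^ 2 := Real.sq_sqrt hp.le
  let Z : I → Ω → ℝ := fun k ω => a * X k ω + b * Y k ω
  let V : Ω → ℝ := fun ω => σ⁻¹ * (Z j ω - r * Z i ω)
  let LZ : I → ((I → ℝ) × (I → ℝ)) →L[ℝ] ℝ := fun k =>
    a • (ContinuousLinearMap.proj (R := ℝ) (φ := fun _ : I => ℝ) k).comp (ContinuousLinearMap.fst ℝ _ _)
      + b • (ContinuousLinearMap.proj (R := ℝ) (φ := fun _ : I => ℝ) k).comp (ContinuousLinearMap.snd ℝ (I → ℝ) (I → ℝ))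
  have hlaw : HasGaussianLaw (fun ω => (Z i ω, V ω)) P :=
    S.law.map ((LZ i).prod (σ⁻¹ • (LZ j - r • LZ i)))
  have hZl : ∀ k, HasGaussianLaw (Z k) P := fun k => S.law.map (LZ k)
  have hZ2 := fun k => (hZl k).memLp_two
  have hVl : HasGaussianLaw V P := hlaw.snd
  have hcZ : ∀ k l, cov[Z k, Z l; P] = a ^ 2 * Δ₀ k l + b ^ 2 * Δ₁ k l := by
    intro k l
    rw [S.cov_comb]; ring
  have hcov : cov[Z i, V; P] = 0 := by
    simp only [V]
    rw [covariance_const_mul_right, covariance_fun_sub_right (hZ2 i) (hZ2 j) ((hZ2 i).const_mul r),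
      covariance_const_mul_right, hcZ, hcZ, h0, h1]
    rw [mul_one, mul_one, hab, ← hr]; simp
  have hind := hlaw.indepFun_of_covariance_eq_zero hcov
  have hU := S.law_comb a b i (h0 i) (h1 i) hab
  have hV : P.map V = gaussianReal 0 1 := by
    rw [hVl.map_eq_gaussianReal]
    have mZ : ∀ k, ∫ ω, Z k ω ∂P = 0 := by
      intro k
      simp only [Z]
      rw [integral_add ((S.lX k).integrable.const_mul a) ((S.lY k).integrable.const_mul b),
        integral_const_mul, integral_const_mul, S.mX, S.mY]; simp
    have m : ∫ ω, V ω ∂P = 0 := by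
      simp only [V]
      rw [integral_const_mul, integral_sub (hZl j).integrable ((hZl i).integrable.const_mul r),
        integral_const_mul, mZ, mZ]; simp
    have v : Var[V; P] = 1 := by
      rw [← covariance_self hVl.aemeasurable]
      have hd : MemLp (fun ω => Z j ω - r * Z i ω) 2 P := (hZ2 j).sub ((hZ2 i).const_mul r)
      simp only [V]
      rw [covariance_const_mul_right, covariance_const_mul_left,
        covariance_fun_sub_right hd (hZ2 j) ((hZ2 i).const_mul r),
        covariance_fun_sub_left (hZ2 j) ((hZ2 i).const_mul r) (hZ2 j),
        covariance_fun_sub_left (hZ2 j) ((hZ2 i).const_mul r) ((hZ2 i).const_mul r)]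
      simp only [covariance_const_mul_left, covariance_const_mul_right, hcZ]
      rw [h0, h1, h0, h1, hsym0 j i, hsym1 j i, ← hr, mul_one, mul_one, hab]
      have : σ ≠ 0 := hσ0.ne'
      field_simp
      rw [hσ2]; ring
    rw [m, v]; simp
  have := density_bound hind hU hV (hZl i).aemeasurable hVl.aemeasurable hgc hg0 hM hsupp hgi hg1
    hr1 hr2 hq
  refine Eq.trans_le ?_ this
  congr 1
  ext ω
  congr 2
  simp only [V, Z, ← hσ]
  field_simp
  ring

/-- Gaussian integration by parts for the product function. -/
lemma ibp (S : Setup P X Y Δ₀ Δ₁) (h0 : ∀ i, Δ₀ i i = 1) (h1 : ∀ i, Δ₁ i i = 1)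
    {a b : ℝ} (hab : a ^ 2 + b ^ 2 = 1) (i : I)
    {φ g : ℝ → ℝ} {M : ℝ} (hφ : ∀ x, HasDerivAt φ (- g x) x) (hgc : Continuous g)
    (hg0 : ∀ x, 0 ≤ g x) (hM : ∀ x, g x ≤ M) (hφ0 : ∀ x, 0 ≤ φ x) (hφ1 : ∀ x, φ x ≤ 1) :
    ∫ ω, (b * X i ω + (-a) * Y i ω) * ((∏ k ∈ Finset.univ.erase i, φ (a * X k ω + b * Y k ω)) *
        (- g (a * X i ω + b * Y i ω))) ∂P
      = ∫ ω, (∑ j ∈ Finset.univ.erase i, (a * b * (Δ₀ i j - Δ₁ i j)) *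
          ((∏ k ∈ (Finset.univ.erase i).erase j, φ (a * X k ω + b * Y k ω)) *
          (g (a * X i ω + b * Y i ω) * g (a * X j ω + b * Y j ω)))) ∂P := by
  let Z : I → Ω → ℝ := fun k ω => a * X k ω + b * Y k ω
  let W : Ω → ℝ := fun ω => b * X i ω + (-a) * Y i ω
  let c : I → ℝ := fun j => a * b * (Δ₀ i j - Δ₁ i j)
  let Z' : I → Ω → ℝ := fun k ω => Z k ω - c k * W ω
  let L2 : ℝ → ℝ → I → ((I → ℝ) × (I → ℝ)) →L[ℝ] ℝ := fun a b k =>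
    a • (ContinuousLinearMap.proj (R := ℝ) (φ := fun _ : I => ℝ) k).comp (ContinuousLinearMap.fst ℝ _ _)
      + b • (ContinuousLinearMap.proj (R := ℝ) (φ := fun _ : I => ℝ) k).comp (ContinuousLinearMap.snd ℝ (I → ℝ) (I → ℝ))
  have hlaw : HasGaussianLaw (fun ω => ((fun _ : Unit => W ω), (fun k => Z' k ω))) P :=
    S.law.map ((ContinuousLinearMap.pi fun _ : Unit => L2 b (-a) i).prod
      (ContinuousLinearMap.pi fun k => (L2 a b k - c k • L2 b (-a) i)))
  have hZl : ∀ k, HasGaussianLaw (Z k) P := fun k => S.law.map (L2 a b k)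
  have hWl : HasGaussianLaw W P := S.law.map (L2 b (-a) i)
  have hZ2 := fun k => (hZl k).memLp_two
  have hW2 := hWl.memLp_two
  have hWW : cov[W, W; P] = 1 := by
    rw [S.cov_comb, h0, h1]; linarith
  have hcov : ∀ (u : Unit) k, cov[W, Z' k; P] = 0 := by
    intro _ k
    simp only [Z']
    rw [covariance_fun_sub_right hW2 (hZ2 k) (hW2.const_mul _), covariance_const_mul_right, hWW,
      S.cov_comb]
    simp only [c]; ring
  have hind0 := hlaw.indepFun_of_covariance_eval (X := fun _ : Unit => W) hcov
  have hind : IndepFun W (fun ω k => Z' k ω) P :=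
    hind0.comp (φ := fun f : Unit → ℝ => f ()) (ψ := id) (by fun_prop) measurable_id
  have hWlaw : P.map W = gaussianReal 0 1 := S.law_comb b (-a) i (h0 i) (h1 i) (by linarith)
  have hφc : Continuous φ := continuous_iff_continuousAt.2 fun x => (hφ x).continuousAt
  have hM0 : 0 ≤ M := (hg0 0).trans (hM 0)
  let G : (I → ℝ) → ℝ → ℝ := fun z w => (∏ k ∈ Finset.univ.erase i, φ (z k + c k * w)) * (- g (z i))
  let G' : (I → ℝ) → ℝ → ℝ := fun z w => ∑ j ∈ Finset.univ.erase i, c j *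
    ((∏ k ∈ (Finset.univ.erase i).erase j, φ (z k + c k * w)) * (g (z i) * g (z j + c j * w)))
  have hprod : ∀ (s : Finset I) (z : I → ℝ), |∏ k ∈ s, φ (z k)| ≤ 1 := by
    intro s z
    rw [abs_of_nonneg (Finset.prod_nonneg fun k _ => hφ0 _)]
    exact Finset.prod_le_one (fun k _ => hφ0 _) (fun k _ => hφ1 _)
  have key := stein_indep hind hWlaw hWl.aemeasurable hlaw.snd.aemeasurable (G := G) (G' := G')
    (M := M + ∑ j ∈ Finset.univ.erase i, |c j| * (M * M)) (by
      apply Continuous.measurable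
      simp only [G, Function.uncurry_def]
      fun_prop) (by
      apply Continuous.measurable
      simp only [G', Function.uncurry_def]
      fun_prop) (by
      intro z w
      have hd : ∀ k ∈ Finset.univ.erase i, HasDerivAt (fun w => φ (z k + c k * w))
          (- g (z k + c k * w) * c k) w := by
        intro k _
        have h1 : HasDerivAt (fun w : ℝ => z k + c k * w) (c k) w := by
          simpa using ((hasDerivAt_id w).const_mul (c k)).const_add (z k)
        exact (hφ (z k + c k * w)).comp w h1
      have := (HasDerivAt.fun_finsetProd hd).mul_const (- g (z i))
      convert! this using 1
      simp only [G', Finset.sum_mul, smul_eq_mul]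
      refine Finset.sum_congr rfl fun j _ => ?_
      ring) (by
      intro z
      simp only [G']
      fun_prop) (by
      intro z w
      simp only [G]
      rw [abs_mul, abs_neg, abs_of_nonneg (hg0 _)]
      have h2 := hprod (Finset.univ.erase i) (fun k => z k + c k * w)
      have h3 : 0 ≤ ∑ j ∈ Finset.univ.erase i, |c j| * (M * M) :=
        Finset.sum_nonneg fun j _ => by positivity
      have h4 := mul_le_mul h2 (hM (z i)) (hg0 _) zero_le_one
      linarith) (by
      intro z w
      simp only [G']
      refine (Finset.abs_sum_le_sum_abs _ _).trans ?_
      refine le_trans (Finset.sum_le_sum fun j _ => ?_) (le_add_of_nonneg_left hM0)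
      rw [abs_mul (c j), abs_mul (Finset.prod _ _), abs_of_nonneg (mul_nonneg (hg0 _) (hg0 _))]
      refine mul_le_mul_of_nonneg_left ?_ (abs_nonneg _)
      have h2 := hprod ((Finset.univ.erase i).erase j) (fun k => z k + c k * w)
      have h3 := mul_le_mul (hM (z i)) (hM (z j + c j * w)) (hg0 _) hM0
      have h4 := mul_le_mul h2 h3 (mul_nonneg (hg0 _) (hg0 _)) zero_le_one
      linarith)
  have hci : c i = 0 := by simp [c, h0, h1]
  simp only [G, G', Z', sub_add_cancel, hci, zero_mul, sub_zero] at key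
  exact key

end Setup
end GC
namespace GC
namespace Setup
variable {Ω I : Type*} [MeasurableSpace Ω] [Fintype I] [DecidableEq I] {P : Measure Ω}
    [IsProbabilityMeasure P]
    {X Y : I → Ω → ℝ} {Δ₀ Δ₁ : Matrix I I ℝ}

lemma hasDeriv (S : Setup P X Y Δ₀ Δ₁)
    {φ g : ℝ → ℝ} {M : ℝ} (hφ : ∀ x, HasDerivAt φ (- g x) x) (hgc : Continuous g)
    (hg0 : ∀ x, 0 ≤ g x) (hM : ∀ x, g x ≤ M) (hφ0 : ∀ x, 0 ≤ φ x) (hφ1 : ∀ x, φ x ≤ 1) (θ : ℝ) :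
    HasDerivAt (fun θ => ∫ ω, ∏ k, φ (Real.sin θ * X k ω + Real.cos θ * Y k ω) ∂P)
      (∑ i, ∫ ω, (Real.cos θ * X i ω + (-Real.sin θ) * Y i ω) *
        ((∏ k ∈ Finset.univ.erase i, φ (Real.sin θ * X k ω + Real.cos θ * Y k ω)) *
        (- g (Real.sin θ * X i ω + Real.cos θ * Y i ω))) ∂P) θ := by
  have hφc : Continuous φ := continuous_iff_continuousAt.2 fun x => (hφ x).continuousAt
  have hM0 : 0 ≤ M := (hg0 0).trans (hM 0)
  have hXm := fun k => (S.lX k).aemeasurable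
  have hYm := fun k => (S.lY k).aemeasurable
  have hprod : ∀ (s : Finset I) (z : I → ℝ), |∏ k ∈ s, φ (z k)| ≤ 1 := by
    intro s z
    rw [abs_of_nonneg (Finset.prod_nonneg fun k _ => hφ0 _)]
    exact Finset.prod_le_one (fun k _ => hφ0 _) (fun k _ => hφ1 _)
  let T : I → ℝ → Ω → ℝ := fun i θ ω => (Real.cos θ * X i ω + (-Real.sin θ) * Y i ω) *
        ((∏ k ∈ Finset.univ.erase i, φ (Real.sin θ * X k ω + Real.cos θ * Y k ω)) *
        (- g (Real.sin θ * X i ω + Real.cos θ * Y i ω)))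
  have hφm : Measurable φ := hφc.measurable
  have hgm : Measurable g := hgc.measurable
  have hZm : ∀ θ k, AEMeasurable (fun ω => Real.sin θ * X k ω + Real.cos θ * Y k ω) P := by
    intro θ k
    exact ((hXm k).const_mul _).add ((hYm k).const_mul _)
  have hpm : ∀ θ (s : Finset I), AEMeasurable
      (fun ω => ∏ k ∈ s, φ (Real.sin θ * X k ω + Real.cos θ * Y k ω)) P := by
    intro θ s
    exact Finset.aemeasurable_fun_prod s fun k _ => hφm.comp_aemeasurable (hZm θ k)
  have hTm : ∀ i θ, AEMeasurable (T i θ) P := by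
    intro i θ
    exact (((hXm i).const_mul _).add ((hYm i).const_mul _)).mul
      ((hpm θ _).mul (hgm.comp_aemeasurable (hZm θ i)).neg)
  have hTb : ∀ i θ ω, ‖T i θ ω‖ ≤ (|X i ω| + |Y i ω|) * M := by
    intro i θ ω
    simp only [T, Real.norm_eq_abs]
    rw [abs_mul, abs_mul (Finset.prod _ _), abs_neg, abs_of_nonneg (hg0 _)]
    have h1 := mul_le_mul (hprod (Finset.univ.erase i)
      (fun k => Real.sin θ * X k ω + Real.cos θ * Y k ω))
      (hM (Real.sin θ * X i ω + Real.cos θ * Y i ω)) (hg0 _) zero_le_one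
    rw [one_mul] at h1
    refine mul_le_mul ?_ h1 (mul_nonneg (abs_nonneg _) (hg0 _)) (by positivity)
    refine (abs_add_le _ _).trans ?_
    rw [abs_mul, abs_mul, abs_neg]
    exact add_le_add (mul_le_of_le_one_left (abs_nonneg _) (Real.abs_cos_le_one _))
      (mul_le_of_le_one_left (abs_nonneg _) (Real.abs_sin_le_one _))
  have hbi : ∀ i, Integrable (fun ω => (|X i ω| + |Y i ω|) * M) P := fun i =>
    ((S.lX i).integrable.abs.add (S.lY i).integrable.abs).mul_const M
  have hTi : ∀ i θ, Integrable (T i θ) P := fun i θ =>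
    (hbi i).mono' (hTm i θ).aestronglyMeasurable (Filter.Eventually.of_forall (hTb i θ))
  have key := hasDerivAt_integral_of_dominated_loc_of_deriv_le (μ := P) (x₀ := θ) (s := Set.univ)
    (F := fun θ ω => ∏ k, φ (Real.sin θ * X k ω + Real.cos θ * Y k ω))
    (F' := fun θ ω => ∑ i, T i θ ω) (bound := fun ω => ∑ i, (|X i ω| + |Y i ω|) * M)
    Filter.univ_mem (Filter.Eventually.of_forall fun t => (hpm t _).aestronglyMeasurable)
    (Integrable.of_bound (hpm θ _).aestronglyMeasurable 1
      (Filter.Eventually.of_forall fun ω => hprod _ _))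
    (Finset.aemeasurable_fun_sum _ fun i _ => hTm i θ).aestronglyMeasurable
    (Filter.Eventually.of_forall fun ω t _ =>
      (norm_sum_le _ _).trans (Finset.sum_le_sum fun i _ => hTb i t ω))
    (integrable_finsetSum _ fun i _ => hbi i)
    (Filter.Eventually.of_forall fun ω t _ => by
      have hd : ∀ k ∈ Finset.univ, HasDerivAt
          (fun t => φ (Real.sin t * X k ω + Real.cos t * Y k ω))
          (- g (Real.sin t * X k ω + Real.cos t * Y k ω) *
            (Real.cos t * X k ω + (-Real.sin t) * Y k ω)) t := by
        intro k _
        exact (hφ _).comp t (((Real.hasDerivAt_sin t).mul_const (X k ω)).add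
          ((Real.hasDerivAt_cos t).mul_const (Y k ω)))
      convert! HasDerivAt.fun_finsetProd hd using 1
      refine Finset.sum_congr rfl fun i _ => ?_
      simp only [T, smul_eq_mul]; ring)
  have h2 := key.2
  rw [integral_finsetSum _ fun i _ => hTi i θ] at h2
  exact h2

lemma deriv_bound (S : Setup P X Y Δ₀ Δ₁) (h0 : ∀ i, Δ₀ i i = 1) (h1 : ∀ i, Δ₁ i i = 1)
    (hsym0 : ∀ i j, Δ₀ i j = Δ₀ j i) (hsym1 : ∀ i j, Δ₁ i j = Δ₁ j i)
    (hoff₀ : ∀ i j, i ≠ j → |Δ₀ i j| < 1) (hoff₁ : ∀ i j, i ≠ j → |Δ₁ i j| < 1)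
    {φ g : ℝ → ℝ} {M s ε q : ℝ} (hφ : ∀ x, HasDerivAt φ (- g x) x) (hgc : Continuous g)
    (hg0 : ∀ x, 0 ≤ g x) (hM : ∀ x, g x ≤ M) (hφ0 : ∀ x, 0 ≤ φ x) (hφ1 : ∀ x, φ x ≤ 1)
    (hsupp : ∀ x, g x ≠ 0 → s ≤ x ∧ x ≤ s + ε) (hgi : Integrable g) (hg1 : ∫ x, g x = 1)
    (hq0 : 0 ≤ q) (hq : ∀ u, s ≤ u → u ≤ s + ε → q ≤ u ^ 2)
    {a b : ℝ} (ha : 0 ≤ a) (hb : 0 ≤ b) (hab : a ^ 2 + b ^ 2 = 1) :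
    (∑ i, ∫ ω, (b * X i ω + (-a) * Y i ω) *
        ((∏ k ∈ Finset.univ.erase i, φ (a * X k ω + b * Y k ω)) *
        (- g (a * X i ω + b * Y i ω))) ∂P)
      ≤ ∑ i, ∑ j ∈ Finset.univ.erase i, max (Δ₀ i j - Δ₁ i j) 0 *
          Real.exp (-q / (1 + max (Δ₀ i j) (Δ₁ i j))) *
          ((Real.sqrt (1 - (a ^ 2 * Δ₀ i j + (1 - a ^ 2) * Δ₁ i j) ^ 2))⁻¹ * (2 * a * b)) := by
  have hφc : Continuous φ := continuous_iff_continuousAt.2 fun x => (hφ x).continuousAt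
  have hM0 : 0 ≤ M := (hg0 0).trans (hM 0)
  have hXm := fun k => (S.lX k).aemeasurable
  have hYm := fun k => (S.lY k).aemeasurable
  have hφm : Measurable φ := hφc.measurable
  have hgm : Measurable g := hgc.measurable
  have hb2 : b ^ 2 = 1 - a ^ 2 := by linarith
  have hZm : ∀ k, AEMeasurable (fun ω => a * X k ω + b * Y k ω) P := by
    intro k
    exact ((hXm k).const_mul _).add ((hYm k).const_mul _)
  have hpm : ∀ (s : Finset I), AEMeasurable
      (fun ω => ∏ k ∈ s, φ (a * X k ω + b * Y k ω)) P := by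
    intro s
    exact Finset.aemeasurable_fun_prod s fun k _ => hφm.comp_aemeasurable (hZm k)
  have hpr0 : ∀ (s : Finset I) (ω : Ω), 0 ≤ ∏ k ∈ s, φ (a * X k ω + b * Y k ω) :=
    fun s ω => Finset.prod_nonneg fun k _ => hφ0 _
  have hpr1 : ∀ (s : Finset I) (ω : Ω), ∏ k ∈ s, φ (a * X k ω + b * Y k ω) ≤ 1 :=
    fun s ω => Finset.prod_le_one (fun k _ => hφ0 _) (fun k _ => hφ1 _)
  have hgg : ∀ i j, Integrable
      (fun ω => g (a * X i ω + b * Y i ω) * g (a * X j ω + b * Y j ω)) P := by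
    intro i j
    refine Integrable.of_bound ((hgm.comp_aemeasurable (hZm i)).mul
      (hgm.comp_aemeasurable (hZm j))).aestronglyMeasurable (M * M)
      (Filter.Eventually.of_forall fun ω => ?_)
    rw [Real.norm_of_nonneg (mul_nonneg (hg0 _) (hg0 _))]
    exact mul_le_mul (hM _) (hM _) (hg0 _) hM0
  refine Finset.sum_le_sum fun i _ => ?_
  rw [S.ibp h0 h1 hab i hφ hgc hg0 hM hφ0 hφ1]
  have hpi : ∀ j, Integrable (fun ω => 
      ((∏ k ∈ (Finset.univ.erase i).erase j, φ (a * X k ω + b * Y k ω)) *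
          (g (a * X i ω + b * Y i ω) * g (a * X j ω + b * Y j ω)))) P := by
    intro j
    refine (hgg i j).bdd_mul (c := 1) (hpm _).aestronglyMeasurable
      (Filter.Eventually.of_forall fun ω => ?_)
    rw [Real.norm_of_nonneg (hpr0 _ _)]; exact hpr1 _ _
  rw [integral_finsetSum _ fun j _ => (hpi j).const_mul _]
  refine Finset.sum_le_sum fun j hj => ?_
  rw [integral_const_mul]
  have hij : i ≠ j := (Finset.ne_of_mem_erase hj).symm
  obtain ⟨l0, u0⟩ := abs_lt.1 (hoff₀ i j hij)
  obtain ⟨l1, u1⟩ := abs_lt.1 (hoff₁ i j hij)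
  set m := max (Δ₀ i j) (Δ₁ i j) with hm
  set r := a ^ 2 * Δ₀ i j + b ^ 2 * Δ₁ i j with hr
  have ha2 : 0 ≤ a ^ 2 := sq_nonneg a
  have hbb : 0 ≤ b ^ 2 := sq_nonneg b
  have hrm : r ≤ m := by
    have e1 : a ^ 2 * Δ₀ i j ≤ a ^ 2 * m := mul_le_mul_of_nonneg_left (le_max_left _ _) ha2
    have e2 : b ^ 2 * Δ₁ i j ≤ b ^ 2 * m := mul_le_mul_of_nonneg_left (le_max_right _ _) hbb
    have : a ^ 2 * m + b ^ 2 * m = m := by rw [← add_mul, hab, one_mul]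
    linarith
  have hm1 : m < 1 := max_lt u0 u1
  have hr1 : -1 < r := by
    have e1 : a ^ 2 * min (Δ₀ i j) (Δ₁ i j) ≤ a ^ 2 * Δ₀ i j :=
      mul_le_mul_of_nonneg_left (min_le_left _ _) ha2
    have e2 : b ^ 2 * min (Δ₀ i j) (Δ₁ i j) ≤ b ^ 2 * Δ₁ i j :=
      mul_le_mul_of_nonneg_left (min_le_right _ _) hbb
    have e3 : a ^ 2 * min (Δ₀ i j) (Δ₁ i j) + b ^ 2 * min (Δ₀ i j) (Δ₁ i j)
      = min (Δ₀ i j) (Δ₁ i j) := by rw [← add_mul, hab, one_mul]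
    have e4 : -1 < min (Δ₀ i j) (Δ₁ i j) := lt_min l0 l1
    linarith
  have hr2 : r < 1 := by linarith
  have hpb := S.pair_bound h0 h1 hsym0 hsym1 hab i j hgc hg0 hM hsupp hgi hg1 hr1 hr2 hq
  rw [← hr] at hpb
  rw [← hb2, ← hr]
  set A := (Real.sqrt (1 - r ^ 2))⁻¹ with hA
  have hA0 : 0 ≤ A := by positivity
  have hexp : Real.exp (-q / (1 + r)) ≤ Real.exp (-q / (1 + m)) := by
    apply Real.exp_le_exp.2
    rw [neg_div, neg_div, neg_le_neg_iff]
    exact div_le_div_of_nonneg_left hq0 (by linarith) (by linarith)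
  set J := ∫ ω, ((∏ k ∈ (Finset.univ.erase i).erase j, φ (a * X k ω + b * Y k ω)) *
          (g (a * X i ω + b * Y i ω) * g (a * X j ω + b * Y j ω))) ∂P with hJ
  have hJ0 : 0 ≤ J := integral_nonneg fun ω =>
    mul_nonneg (hpr0 _ _) (mul_nonneg (hg0 _) (hg0 _))
  have hJ1 : J ≤ Real.exp (-q / (1 + m)) * A := by
    refine le_trans ?_ (hpb.trans (mul_le_mul_of_nonneg_right hexp hA0))
    refine integral_mono (hpi j) (hgg i j) fun ω => ?_
    exact mul_le_of_le_one_left (mul_nonneg (hg0 _) (hg0 _)) (hpr1 _ _)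
  have hab0 : 0 ≤ a * b := mul_nonneg ha hb
  set D := max (Δ₀ i j - Δ₁ i j) 0 with hD
  have hD0 : 0 ≤ D := le_max_right _ _
  calc a * b * (Δ₀ i j - Δ₁ i j) * J ≤ a * b * D * J := by
        refine mul_le_mul_of_nonneg_right (mul_le_mul_of_nonneg_left (le_max_left _ _) hab0) hJ0
    _ ≤ a * b * D * (Real.exp (-q / (1 + m)) * A) :=
        mul_le_mul_of_nonneg_left hJ1 (mul_nonneg hab0 hD0)
    _ ≤ 2 * (a * b * D * (Real.exp (-q / (1 + m)) * A)) := by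
        have : 0 ≤ a * b * D * (Real.exp (-q / (1 + m)) * A) := by positivity
        linarith
    _ = _ := by ring

lemma smooth_compare (S : Setup P X Y Δ₀ Δ₁) (h0 : ∀ i, Δ₀ i i = 1) (h1 : ∀ i, Δ₁ i i = 1)
    (hsym0 : ∀ i j, Δ₀ i j = Δ₀ j i) (hsym1 : ∀ i j, Δ₁ i j = Δ₁ j i)
    (hoff₀ : ∀ i j, i ≠ j → |Δ₀ i j| < 1) (hoff₁ : ∀ i j, i ≠ j → |Δ₁ i j| < 1)
    {φ g : ℝ → ℝ} {M s ε q : ℝ} (hφ : ∀ x, HasDerivAt φ (- g x) x) (hgc : Continuous g)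
    (hg0 : ∀ x, 0 ≤ g x) (hM : ∀ x, g x ≤ M) (hφ0 : ∀ x, 0 ≤ φ x) (hφ1 : ∀ x, φ x ≤ 1)
    (hsupp : ∀ x, g x ≠ 0 → s ≤ x ∧ x ≤ s + ε) (hgi : Integrable g) (hg1 : ∫ x, g x = 1)
    (hq0 : 0 ≤ q) (hq : ∀ u, s ≤ u → u ≤ s + ε → q ≤ u ^ 2) :
    (∫ ω, ∏ k, φ (X k ω) ∂P) - (∫ ω, ∏ k, φ (Y k ω) ∂P)
      ≤ ∑ i, ∑ j ∈ Finset.univ.erase i, max (Δ₀ i j - Δ₁ i j) 0 *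
          Real.exp (-q / (1 + max (Δ₀ i j) (Δ₁ i j))) *
          ∫ h in (0:ℝ)..1, (Real.sqrt (1 - (h * Δ₀ i j + (1 - h) * Δ₁ i j) ^ 2))⁻¹ := by
  let f : I → I → ℝ → ℝ := fun i j h => (Real.sqrt (1 - (h * Δ₀ i j + (1 - h) * Δ₁ i j) ^ 2))⁻¹
  let C : I → I → ℝ := fun i j => max (Δ₀ i j - Δ₁ i j) 0 *
          Real.exp (-q / (1 + max (Δ₀ i j) (Δ₁ i j)))
  let F : ℝ → ℝ := fun θ => ∫ ω, ∏ k, φ (Real.sin θ * X k ω + Real.cos θ * Y k ω) ∂P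
  let B : ℝ → ℝ := fun θ => ∑ i, ∑ j ∈ Finset.univ.erase i,
    C i j * ∫ h in (0:ℝ)..(Real.sin θ ^ 2), f i j h
  have hpos : ∀ i j, i ≠ j → ∀ h ∈ Set.Icc (0:ℝ) 1,
      0 < 1 - (h * Δ₀ i j + (1 - h) * Δ₁ i j) ^ 2 := by
    intro i j hij h hh
    obtain ⟨l0, u0⟩ := abs_lt.1 (hoff₀ i j hij)
    obtain ⟨l1, u1⟩ := abs_lt.1 (hoff₁ i j hij)
    have hc : h * Δ₀ i j + (1 - h) * Δ₁ i j ∈ Set.Ioo (-1:ℝ) 1 := by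
      have := (convex_Ioo (-1:ℝ) 1) (x := Δ₀ i j) ⟨l0, u0⟩ (y := Δ₁ i j) ⟨l1, u1⟩ hh.1
        (sub_nonneg.2 hh.2) (by ring)
      simpa using this
    nlinarith [hc.1, hc.2]
  have hca : ∀ i j, i ≠ j → ∀ h ∈ Set.Icc (0:ℝ) 1, ContinuousAt (f i j) h := by
    intro i j hij h hh
    have := hpos i j hij h hh
    refine ContinuousAt.inv₀ (by fun_prop) (Real.sqrt_pos.2 this).ne'
  have hfm : ∀ i j, Measurable (f i j) := by intro i j; simp only [f]; fun_prop
  have hBd : ∀ θ, HasDerivAt B (∑ i, ∑ j ∈ Finset.univ.erase i,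
      C i j * (f i j (Real.sin θ ^ 2) * (2 * Real.sin θ * Real.cos θ))) θ := by
    intro θ
    refine HasDerivAt.fun_sum fun i _ => HasDerivAt.fun_sum fun j hj => ?_
    have hij : i ≠ j := (Finset.ne_of_mem_erase hj).symm
    refine HasDerivAt.const_mul _ ?_
    have hsq : Real.sin θ ^ 2 ∈ Set.Icc (0:ℝ) 1 := ⟨sq_nonneg _, Real.sin_sq_le_one _⟩
    have hF : HasDerivAt (fun u => ∫ h in (0:ℝ)..u, f i j h) (f i j (Real.sin θ ^ 2))
        (Real.sin θ ^ 2) := by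
      refine intervalIntegral.integral_hasDerivAt_right ?_
        ((hfm i j).stronglyMeasurable.stronglyMeasurableAtFilter) (hca i j hij _ hsq)
      refine ContinuousOn.intervalIntegrable fun h hh => ?_
      rw [Set.uIcc_of_le hsq.1] at hh
      exact (hca i j hij h ⟨hh.1, hh.2.trans hsq.2⟩).continuousWithinAt
    have hs : HasDerivAt (fun θ => Real.sin θ ^ 2) (2 * Real.sin θ * Real.cos θ) θ := by
      have h2 := (Real.hasDerivAt_sin θ).pow 2
      convert! h2 using 1
      simp
    exact hF.comp θ hs
  have hFd := fun θ => S.hasDeriv hφ hgc hg0 hM hφ0 hφ1 θ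
  have hanti : AntitoneOn (fun θ => F θ - B θ) (Set.Icc 0 (Real.pi / 2)) := by
    refine antitoneOn_of_deriv_nonpos (convex_Icc _ _)
      (fun θ _ => ((hFd θ).sub (hBd θ)).continuousAt.continuousWithinAt)
      (fun θ _ => ((hFd θ).sub (hBd θ)).differentiableAt.differentiableWithinAt) ?_
    intro θ hθ
    rw [interior_Icc] at hθ
    refine Eq.trans_le ((hFd θ).sub (hBd θ)).deriv (sub_nonpos.2 ?_)
    exact S.deriv_bound h0 h1 hsym0 hsym1 hoff₀ hoff₁ hφ hgc hg0 hM hφ0 hφ1 hsupp hgi hg1 hq0 hq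
      (Real.sin_nonneg_of_nonneg_of_le_pi hθ.1.le (by linarith [hθ.2, Real.pi_pos]))
      (Real.cos_nonneg_of_neg_pi_div_two_le_of_le (by linarith [hθ.1, Real.pi_pos]) hθ.2.le)
      (Real.sin_sq_add_cos_sq θ)
  have hpi2 : (0:ℝ) ≤ Real.pi / 2 := by positivity
  have := hanti (Set.left_mem_Icc.2 hpi2) (Set.right_mem_Icc.2 hpi2) hpi2
  simp only [F, B, Real.sin_pi_div_two, Real.cos_pi_div_two, Real.sin_zero, Real.cos_zero,
    one_mul, zero_mul, add_zero, zero_add, one_pow, ne_eq, OfNat.ofNat_ne_zero, not_false_eq_true,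
    zero_pow, intervalIntegral.integral_same, mul_zero, Finset.sum_const_zero, sub_zero] at this
  rw [sub_le_iff_le_add, add_comm]
  exact sub_le_iff_le_add.1 this

end Setup
end GC
namespace GC
open Filter Topology

lemma tendsto_prob {Ω I : Type*} [MeasurableSpace Ω] [Fintype I] {P : Measure Ω}
    [IsProbabilityMeasure P] {X : I → Ω → ℝ} (hX : ∀ i, AEMeasurable (X i) P) {s : ℝ}
    {φ : ℕ → ℝ → ℝ} {ε : ℕ → ℝ} (hε : Tendsto ε atTop (𝓝 0)) (hc : ∀ n, Continuous (φ n))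
    (hφ0 : ∀ n x, 0 ≤ φ n x) (hφ1 : ∀ n x, φ n x ≤ 1)
    (h1 : ∀ n x, x ≤ s → φ n x = 1) (h0 : ∀ n x, s + ε n ≤ x → φ n x = 0) :
    Tendsto (fun n => ∫ ω, ∏ k, φ n (X k ω) ∂P) atTop (𝓝 (P {ω | ∀ i, X i ω ≤ s}).toReal) := by
  have hA : NullMeasurableSet {ω | ∀ i, X i ω ≤ s} P := by
    have : {ω | ∀ i, X i ω ≤ s} = ⋂ i, {ω | X i ω ≤ s} := by ext; simp
    rw [this]
    exact NullMeasurableSet.iInter fun i => nullMeasurableSet_le (hX i) aemeasurable_const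
  have e : (P {ω | ∀ i, X i ω ≤ s}).toReal
      = ∫ ω, Set.indicator {ω | ∀ i, X i ω ≤ s} (fun _ => (1:ℝ)) ω ∂P := by
    rw [integral_indicator₀ hA]
    simp [Measure.real]
  rw [e]
  refine tendsto_integral_of_dominated_convergence (fun _ => 1) (fun n => ?_) (integrable_const _)
    (fun n => Eventually.of_forall fun ω => ?_) (Eventually.of_forall fun ω => ?_)
  · exact (Finset.aemeasurable_fun_prod _ fun k _ =>
      (hc n).measurable.comp_aemeasurable (hX k)).aestronglyMeasurable
  · rw [Real.norm_of_nonneg (Finset.prod_nonneg fun k _ => hφ0 _ _)]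
    exact Finset.prod_le_one (fun k _ => hφ0 _ _) (fun k _ => hφ1 _ _)
  · by_cases hω : ∀ i, X i ω ≤ s
    · rw [Set.indicator_of_mem (by exact hω)]
      refine tendsto_const_nhds.congr fun n => ?_
      exact (Finset.prod_eq_one fun k _ => h1 n _ (hω k)).symm
    · rw [Set.indicator_of_notMem (by exact hω)]
      push Not at hω
      obtain ⟨i, hi⟩ := hω
      refine tendsto_const_nhds.congr' ?_
      have : ∀ᶠ n in atTop, ε n < X i ω - s := hε.eventually (gt_mem_nhds (by linarith))
      filter_upwards [this] with n hn
      exact (Finset.prod_eq_zero (Finset.mem_univ i) (h0 n _ (by linarith))).symm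

lemma Setup.compare {Ω I : Type*} [MeasurableSpace Ω] [Fintype I] [DecidableEq I] {P : Measure Ω}
    [IsProbabilityMeasure P]
    {X Y : I → Ω → ℝ} {Δ₀ Δ₁ : Matrix I I ℝ}
    (S : Setup P X Y Δ₀ Δ₁) (h0 : ∀ i, Δ₀ i i = 1) (h1 : ∀ i, Δ₁ i i = 1)
    (hsym0 : ∀ i j, Δ₀ i j = Δ₀ j i) (hsym1 : ∀ i j, Δ₁ i j = Δ₁ j i)
    (hoff₀ : ∀ i j, i ≠ j → |Δ₀ i j| < 1) (hoff₁ : ∀ i j, i ≠ j → |Δ₁ i j| < 1) (s : ℝ) :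
    (P {ω | ∀ i, X i ω ≤ s}).toReal - (P {ω | ∀ i, Y i ω ≤ s}).toReal
      ≤ ∑ i, ∑ j ∈ Finset.univ.erase i, max (Δ₀ i j - Δ₁ i j) 0 *
          Real.exp (-s ^ 2 / (1 + max (Δ₀ i j) (Δ₁ i j))) *
          ∫ h in (0:ℝ)..1, (Real.sqrt (1 - (h * Δ₀ i j + (1 - h) * Δ₁ i j) ^ 2))⁻¹ := by
  let ε : ℕ → ℝ := fun n => 1 / ((n : ℝ) + 1)
  have hε0 : ∀ n, 0 < ε n := fun n => by positivity
  have hε : Tendsto ε atTop (𝓝 0) := tendsto_one_div_add_atTop_nhds_zero_nat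
  choose φ g M hφ hgc hg0 hM hsupp hgi hg1 hφ0 hφ1 hone hzero using
    fun n => exists_cutoff s (ε n) (hε0 n)
  let q : ℕ → ℝ := fun n => max (s ^ 2 - 2 * |s| * ε n) 0
  have hq : Tendsto q atTop (𝓝 (s ^ 2)) := by
    have : Tendsto q atTop (𝓝 (max (s ^ 2 - 2 * |s| * 0) 0)) :=
      (tendsto_const_nhds.sub (hε.const_mul _)).max tendsto_const_nhds
    simpa [sq_nonneg] using this
  have hc : ∀ n, Continuous (φ n) := fun n =>
    continuous_iff_continuousAt.2 fun x => (hφ n x).continuousAt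
  have lim1 := (tendsto_prob (P := P) (X := X) (fun i => (S.lX i).aemeasurable) hε hc hφ0 hφ1
    hone hzero).sub (tendsto_prob (P := P) (X := Y) (fun i => (S.lY i).aemeasurable) hε hc hφ0 hφ1
    hone hzero)
  refine le_of_tendsto_of_tendsto' lim1 (f := fun n => (∫ ω, ∏ k, φ n (X k ω) ∂P) - (∫ ω, ∏ k, φ n (Y k ω) ∂P))
    (g := fun n => ∑ i, ∑ j ∈ Finset.univ.erase i, max (Δ₀ i j - Δ₁ i j) 0 *
          Real.exp (-q n / (1 + max (Δ₀ i j) (Δ₁ i j))) *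
          ∫ h in (0:ℝ)..1, (Real.sqrt (1 - (h * Δ₀ i j + (1 - h) * Δ₁ i j) ^ 2))⁻¹) ?_ ?_
  · refine tendsto_finsetSum _ fun i _ => tendsto_finsetSum _ fun j _ => ?_
    refine Tendsto.mul_const _ (Tendsto.const_mul _ ?_)
    exact (Real.continuous_exp.tendsto _).comp (hq.neg.div_const _)
  · intro n
    refine S.smooth_compare h0 h1 hsym0 hsym1 hoff₀ hoff₁ (hφ n) (hgc n) (hg0 n) (hM n) (hφ0 n)
      (hφ1 n) (hsupp n) (hgi n) (hg1 n) (le_max_right _ _) ?_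
    intro u hu1 hu2
    refine max_le ?_ (sq_nonneg _)
    have a1 : 0 ≤ u - s := by linarith
    have a2 : u - s ≤ ε n := by linarith
    have a3 : -(|s| * ε n) ≤ s * (u - s) := by
      have b1 : |s * (u - s)| ≤ |s| * ε n := by
        rw [abs_mul, abs_of_nonneg a1]
        exact mul_le_mul_of_nonneg_left a2 (abs_nonneg _)
      linarith [neg_abs_le (s * (u - s))]
    nlinarith [sq_nonneg (u - s)]

lemma map_tr {Ω E : Type*} [MeasurableSpace Ω] [MeasurableSpace E] {P : Measure Ω}
    [IsProbabilityMeasure P] {f : Ω × Ω → Ω} (hf : MeasurePreserving f (P.prod P) P)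
    {Z : Ω → E} (hZ : AEMeasurable Z P) :
    (P.prod P).map (fun p => Z (f p)) = P.map Z := by
  have hZ' : AEMeasurable Z ((P.prod P).map f) := by rwa [hf.map_eq]
  have := AEMeasurable.map_map_of_aemeasurable hZ' hf.aemeasurable
  rw [hf.map_eq] at this
  exact this.symm

lemma setup_prod {I : Type*} [Fintype I] [DecidableEq I]
    {Ω : Type*} [MeasurableSpace Ω] (P : Measure Ω) [IsProbabilityMeasure P]
    (X₀ X₁ : I → Ω → ℝ) (Δ₀ Δ₁ : Matrix I I ℝ)
    (hPD₀ : Δ₀.PosDef) (hPD₁ : Δ₁.PosDef)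
    (hG₀ : IsCenteredGaussianVector P X₀ Δ₀) (hG₁ : IsCenteredGaussianVector P X₁ Δ₁) :
    Setup (P.prod P) (fun i (p : Ω × Ω) => X₀ i p.1) (fun i (p : Ω × Ω) => X₁ i p.2) Δ₀ Δ₁ := by
  have hf : MeasurePreserving (Prod.fst : Ω × Ω → Ω) (P.prod P) P := measurePreserving_fst
  have hs : MeasurePreserving (Prod.snd : Ω × Ω → Ω) (P.prod P) P := measurePreserving_snd
  have m0 := aemeas hG₀
  have m1 := aemeas hG₁
  have v0 : AEMeasurable (fun ω i => X₀ i ω) P := aemeasurable_pi_lambda _ m0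
  have v1 : AEMeasurable (fun ω i => X₁ i ω) P := aemeasurable_pi_lambda _ m1
  have l0 : HasGaussianLaw (fun (p : Ω × Ω) i => X₀ i p.1) (P.prod P) :=
    ⟨by rw [map_tr hf v0]; exact (gaussLaw hG₀).isGaussian_map⟩
  have l1 : HasGaussianLaw (fun (p : Ω × Ω) i => X₁ i p.2) (P.prod P) :=
    ⟨by rw [map_tr hs v1]; exact (gaussLaw hG₁).isGaussian_map⟩
  have hind : IndepFun (fun (p : Ω × Ω) i => X₀ i p.1) (fun (p : Ω × Ω) i => X₁ i p.2)
      (P.prod P) := indepFun_prod₀ v0 v1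
  refine ⟨hind.hasGaussianLaw l0 l1, fun i => ?_, fun i => ?_, fun i j => ?_, fun i j => ?_,
    fun i j => ?_⟩
  · rw [← mean_zero hG₀ i, ← integral_map (φ := fun p : Ω × Ω => X₀ i p.1) (f := fun x => x)
      (l0.eval i).aemeasurable (by fun_prop), map_tr hf (m0 i), integral_map (m0 i) (by fun_prop)]
  · rw [← mean_zero hG₁ i, ← integral_map (φ := fun p : Ω × Ω => X₁ i p.2) (f := fun x => x)
      (l1.eval i).aemeasurable (by fun_prop), map_tr hs (m1 i), integral_map (m1 i) (by fun_prop)]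
  · rw [← cov_eq hG₀ hPD₀ i j]
    conv_rhs => rw [← hf.map_eq]
    rw [covariance_map_fun (by rw [hf.map_eq]; exact (m0 i).aestronglyMeasurable)
      (by rw [hf.map_eq]; exact (m0 j).aestronglyMeasurable) hf.aemeasurable]
  · rw [← cov_eq hG₁ hPD₁ i j]
    conv_rhs => rw [← hs.map_eq]
    rw [covariance_map_fun (by rw [hs.map_eq]; exact (m1 i).aestronglyMeasurable)
      (by rw [hs.map_eq]; exact (m1 j).aestronglyMeasurable) hs.aemeasurable]
  · have hm : ∀ k : I, Measurable (fun f : I → ℝ => f k) := fun k => by fun_prop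
    have := hind.comp (hm i) (hm j)
    exact this.covariance_eq_zero (l0.eval i).memLp_two (l1.eval j).memLp_two

end GC

/-- Normal comparison lemma (adaptation of Theorem 4.2.1 of Leadbetter–Lindgren–Rootzén):
for centered Gaussian vectors `X⁰, X¹` with unit variances and covariances `Δ⁰, Δ¹`,
`P(max X⁰ ≤ s) − P(max X¹ ≤ s)` is bounded by
`Σ_{i≠j} (Δ⁰_{ij} − Δ¹_{ij})⁺ exp(−s²/(1+Δ^m_{ij})) ∫₀¹ (1−(Δ^h_{ij})²)^{-1/2} dh`. -/
theorem gaussian_comparison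
    {I : Type*} [Fintype I] [DecidableEq I] [Nonempty I]
    {Ω : Type*} [MeasurableSpace Ω] (P : Measure Ω) [IsProbabilityMeasure P]
    (X₀ X₁ : I → Ω → ℝ) (Δ₀ Δ₁ : Matrix I I ℝ)
    (hPD₀ : Δ₀.PosDef) (hPD₁ : Δ₁.PosDef)
    (hG₀ : IsCenteredGaussianVector P X₀ Δ₀) (hG₁ : IsCenteredGaussianVector P X₁ Δ₁)
    (hdiag₀ : ∀ i, Δ₀ i i = 1) (hdiag₁ : ∀ i, Δ₁ i i = 1)
    (hoff₀ : ∀ i j, i ≠ j → |Δ₀ i j| < 1) (hoff₁ : ∀ i j, i ≠ j → |Δ₁ i j| < 1)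
    (s : ℝ) :
    (P {ω | ∀ i, X₀ i ω ≤ s}).toReal - (P {ω | ∀ i, X₁ i ω ≤ s}).toReal
      ≤ ∑ i, ∑ j ∈ Finset.univ.erase i,
          max (Δ₀ i j - Δ₁ i j) 0 *
            Real.exp (-s ^ 2 / (1 + max (Δ₀ i j) (Δ₁ i j))) *
            ∫ h in (0:ℝ)..1, (Real.sqrt (1 - (h * Δ₀ i j + (1 - h) * Δ₁ i j) ^ 2))⁻¹ := by

  have hS := GC.setup_prod P X₀ X₁ Δ₀ Δ₁ hPD₀ hPD₁ hG₀ hG₁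
  have hsym : ∀ {Δ : Matrix I I ℝ}, Δ.PosDef → ∀ i j, Δ i j = Δ j i := by
    intro Δ h i j
    have := h.1.apply j i
    simpa using this
  have key := hS.compare hdiag₀ hdiag₁ (hsym hPD₀) (hsym hPD₁) hoff₀ hoff₁ s
  have hA : ∀ {X : I → Ω → ℝ}, (∀ i, AEMeasurable (X i) P) →
      NullMeasurableSet {ω | ∀ i, X i ω ≤ s} P := by
    intro X hX
    have : {ω | ∀ i, X i ω ≤ s} = ⋂ i, {ω | X i ω ≤ s} := by ext; simp
    rw [this]
    exact NullMeasurableSet.iInter fun i => nullMeasurableSet_le (hX i) aemeasurable_const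
  have e0 : (P.prod P) {p : Ω × Ω | ∀ i, X₀ i p.1 ≤ s} = P {ω | ∀ i, X₀ i ω ≤ s} :=
    (measurePreserving_fst (μ := P) (ν := P)).measure_preimage (hA (GC.aemeas hG₀))
  have e1 : (P.prod P) {p : Ω × Ω | ∀ i, X₁ i p.2 ≤ s} = P {ω | ∀ i, X₁ i ω ≤ s} :=
    (measurePreserving_snd (μ := P) (ν := P)).measure_preimage (hA (GC.aemeas hG₁))
  rw [e0, e1] at key
  exact key
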